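/- arXiv:math/0605050 — 2 statements merged into one kernel-verified Lean document; each statement's English description precedes it below -/
import Mathlib

section
/- Let α be any type, let s : ℕ → α be a sequence, and let M, n be integers with 1 ≤ M ≤ n. Then the number of distinct values among s_0, s_1, …, s_{n−1} satisfies |{s_0, …, s_{n−1}}| ≤ M + |{ k : 0 ≤ k ≤ n − M and s_{k+r} ≠ s_k for all 1 ≤ r ≤ M }|. -/
/-- (Last-exit decomposition bound.)  For any sequence `s` in a type
`α` and integers `1 ≤ M ≤ n`, the number of distinct values among `s 0, …, s (n-1)` is
at most `M` plus the number of indices `0 ≤ k ≤ n - M` such that `s (k + r) ≠ s k` for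
all `1 ≤ r ≤ M`. -/
theorem range_le_last_exit_bound {α : Type*} (s : ℕ → α) (M n : ℕ)
    (hM : 1 ≤ M) (hMn : M ≤ n) :
    Set.ncard (s '' Set.Iio n) ≤
      M + Set.ncard {k : ℕ | k ≤ n - M ∧ ∀ r : ℕ, 1 ≤ r → r ≤ M → s (k + r) ≠ s k} := by
  set A : Set ℕ := {k : ℕ | k ≤ n - M ∧ ∀ r : ℕ, 1 ≤ r → r ≤ M → s (k + r) ≠ s k} with hA
  have hAfin : A.Finite := (Set.finite_Iic (n - M)).subset fun k hk => hk.1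
  have key : ∀ d k : ℕ, n - k ≤ d → k < n → s k ∈ s '' Set.Ico (n - M) n ∪ s '' A := by
    intro d
    induction d with
    | zero => intro k h1 h2; omega
    | succ d ih =>
      intro k h1 h2
      by_cases hk : n - M ≤ k
      · exact Or.inl ⟨k, ⟨hk, h2⟩, rfl⟩
      by_cases hkA : k ∈ A
      · exact Or.inr ⟨k, hkA, rfl⟩
      have hex : ∃ r : ℕ, 1 ≤ r ∧ r ≤ M ∧ s (k + r) = s k := by
        by_contra hcon
        exact hkA ⟨by omega, fun r hr1 hr2 h => hcon ⟨r, hr1, hr2, h⟩⟩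
      obtain ⟨r, hr1, hr2, hr⟩ := hex
      rw [← hr]
      exact ih (k + r) (by omega) (by omega)
  have hsub : s '' Set.Iio n ⊆ s '' Set.Ico (n - M) n ∪ s '' A := by
    rintro _ ⟨k, hk, rfl⟩
    exact key (n - k) k le_rfl hk
  have hI : (s '' Set.Ico (n - M) n).ncard ≤ M := by
    refine (Set.ncard_image_le (Set.finite_Ico _ _)).trans ?_
    rw [← Finset.coe_Ico, Set.ncard_coe_finset, Nat.card_Ico]
    omega
  calc (s '' Set.Iio n).ncard
      ≤ (s '' Set.Ico (n - M) n ∪ s '' A).ncard :=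
        Set.ncard_le_ncard hsub (((Set.finite_Ico _ _).image s).union (hAfin.image s))
    _ ≤ (s '' Set.Ico (n - M) n).ncard + (s '' A).ncard := Set.ncard_union_le _ _
    _ ≤ M + A.ncard := Nat.add_le_add hI (Set.ncard_image_le hAfin)
end

section
/- Let d ≥ 1 and n ≥ 1, and let y_0 = 0, y_1, …, y_n = 0 be a nearest-neighbor path in ℤ^d (so ‖y_{k+1} − y_k‖_1 = 1 for all 0 ≤ k < n). Let N = |{y_0, y_1, …, y_{n−1}}| be the number of distinct sites visited before time n. Then the number of sequences σ_0, σ_1, …, σ_n of finitely supported functions ℤ^d → ℤ/2ℤ satisfying σ_0 = σ_n = 0 and, for each 0 ≤ k < n, either σ_{k+1} = σ_k or σ_{k+1} equals σ_k with its value at y_k flipped (i.e. σ_{k+1}(y_k) = σ_k(y_k) + 1 mod 2 and σ_{k+1}(x) = σ_k(x) for x ≠ y_k), is exactly 2^{n−N}. -/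
/-- The kernel of the total flip map has `2 ^ (n - N)` elements. -/
theorem card_ker_flip {X : Type*} (n : ℕ) (y : ℕ → X) :
    Set.ncard {e : Fin n → ZMod 2 | ∑ k : Fin n, Finsupp.single (y (k : ℕ)) (e k) = 0}
      = 2 ^ (n - Set.ncard (y '' Set.Iio n)) := by
  classical
  have : Fact (Nat.Prime 2) := ⟨Nat.prime_two⟩
  let v : Fin n → (X →₀ ZMod 2) := fun k => Finsupp.single (y (k : ℕ)) 1
  let L := Fintype.linearCombination (ZMod 2) v
  have hset : {e : Fin n → ZMod 2 | ∑ k : Fin n, Finsupp.single (y (k : ℕ)) (e k) = 0}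
      = (LinearMap.ker L : Set (Fin n → ZMod 2)) := by
    ext e
    simp [L, v, Fintype.linearCombination_apply]
  have hfin : (y '' Set.Iio n).Finite := (Set.finite_Iio n).image y
  have hr : Module.finrank (ZMod 2) (LinearMap.range L) = Set.ncard (y '' Set.Iio n) := by
    have h1 : LinearMap.range L = Submodule.span (ZMod 2)
        (Set.range (fun x : (y '' Set.Iio n) => (Finsupp.single (x : X) (1 : ZMod 2)))) := by
      rw [Fintype.range_linearCombination]
      congr 1
      ext z
      constructor
      · rintro ⟨k, rfl⟩
        exact ⟨⟨y k, ⟨k, k.2, rfl⟩⟩, rfl⟩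
      · rintro ⟨⟨_, ⟨k, hk, rfl⟩⟩, rfl⟩
        exact ⟨⟨k, hk⟩, rfl⟩
    have := hfin.fintype
    have hli : LinearIndependent (ZMod 2)
        (fun x : (y '' Set.Iio n) => (Finsupp.single (x : X) (1 : ZMod 2))) :=
      (Finsupp.linearIndependent_single_one (ZMod 2) X).comp _ Subtype.val_injective
    rw [h1, finrank_span_eq_card hli, ← Nat.card_eq_fintype_card, Nat.card_coe_set_eq]
  have hk := LinearMap.finrank_range_add_finrank_ker L
  rw [hr, Module.finrank_fin_fun] at hk
  rw [hset, ← Nat.card_coe_set_eq]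
  have := Module.natCard_eq_pow_finrank (K := ZMod 2) (V := LinearMap.ker L)
  rw [Nat.card_zmod] at this
  rw [← Nat.eq_sub_of_add_eq' hk]
  exact this

/-- (Lamp-configuration count along a lamplighter bridge.)  Let
`y 0 = 0, y 1, …, y n = 0` be a nearest-neighbor loop in `ℤ^d` and let
`N = |{y 0, …, y (n-1)}|` be the number of distinct sites it visits before time `n`.
Then the number of sequences `σ 0, …, σ n` of finitely supported lamp configurations
`(Fin d → ℤ) →₀ ZMod 2` with `σ 0 = σ n = 0` such that for each `k < n` either
`σ (k+1) = σ k` or `σ (k+1)` is `σ k` with the lamp at `y k` flipped, equals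
`2 ^ (n - N)`. -/
theorem lamplighter_bridge_configuration_count
    (d n : ℕ) (hd : 1 ≤ d) (hn : 1 ≤ n)
    (y : ℕ → (Fin d → ℤ)) (hy0 : y 0 = 0) (hyn : y n = 0)
    (hnn : ∀ k, k < n → ∑ i : Fin d, (y (k + 1) i - y k i).natAbs = 1)
    (N : ℕ) (hN : N = Set.ncard (y '' Set.Iio n)) :
    Set.ncard {σ : Fin (n + 1) → ((Fin d → ℤ) →₀ ZMod 2) |
        σ 0 = 0 ∧ σ (Fin.last n) = 0 ∧
        ∀ k : Fin n, σ k.succ = σ k.castSucc ∨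
          σ k.succ = σ k.castSucc + Finsupp.single (y (k : ℕ)) 1} = 2 ^ (n - N) := by
  rw [hN, ← card_ker_flip n y]
  let F : (Fin n → ZMod 2) → Fin n → ((Fin d → ℤ) →₀ ZMod 2) :=
    fun e k => Finsupp.single (y (k : ℕ)) (e k)
  have hlast : ∀ e, Fin.partialSum (F e) (Fin.last n) = ∑ k, F e k := by
    intro e
    rw [Fin.partialSum, ← List.sum_ofFn]
    congr 1
    exact List.take_of_length_le (by simp)
  have hinj : Function.Injective (fun e => Fin.partialSum (F e)) := by
    intro e e' h
    funext k
    have h1 := Fin.partialSum_succ (F e) k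
    have h2 := Fin.partialSum_succ (F e') k
    have h' : Fin.partialSum (F e) = Fin.partialSum (F e') := h
    rw [h', h2] at h1
    exact (Finsupp.single_injective _ (add_left_cancel h1)).symm
  rw [← Set.ncard_image_of_injective _ hinj]
  congr 1
  ext σ
  constructor
  · rintro ⟨h0, hl, hs⟩
    have hs' : ∀ k : Fin n, ∃ a : ZMod 2,
        σ k.succ = σ k.castSucc + Finsupp.single (y (k : ℕ)) a := by
      intro k
      rcases hs k with h | h
      · exact ⟨0, by simp [h]⟩
      · exact ⟨1, h⟩
    choose e he using hs'
    have hσ : Fin.partialSum (F e) = σ := by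
      funext j
      induction j using Fin.induction with
      | zero => rw [Fin.partialSum_zero, h0]
      | succ k ih => rw [Fin.partialSum_succ, ih, he k]
    refine ⟨e, ?_, hσ⟩
    have := hlast e
    rw [hσ, hl] at this
    exact this.symm
  · rintro ⟨e, he, rfl⟩
    refine ⟨Fin.partialSum_zero _, (hlast e).trans he, fun k => ?_⟩
    have h1 := Fin.partialSum_succ (F e) k
    have h01 : ∀ a : ZMod 2, a = 0 ∨ a = 1 := by decide
    rcases h01 (e k) with h | h
    · left
      simpa [F, h] using h1
    · right
      simpa [F, h] using h1
end
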